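/- Let R be a 2-dimensional regular local ring containing ℂ with residue field ℂ, with maximal ideal m, A = R[t]/(t²), and I = (t) ⊆ A. Regard m⊗_R I ≅ mI and m as A-modules on which t acts as 0 (via the surjection A → R). Then there is an isomorphism of R-modules Ext¹_A(m, m⊗_R I) ≅ ((m/m²) ⊗_R I) ⊕ R. -/

import Mathlib

open Polynomial

noncomputable section

/-- The primitive multiple ring `R[n] = R[t]/(t^n)`. -/
abbrev Rn (R : Type*) [CommRing R] (n : ℕ) : Type _ :=
  Polynomial R ⧸ Ideal.span {(X : Polynomial R) ^ n}

/-- The class `t` of the variable in `R[n]`. -/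
def tn (R : Type*) [CommRing R] (n : ℕ) : Rn R n :=
  Ideal.Quotient.mk _ X

/-- `R[k] = R[n]/(t^k)` as an `R[n]`-module (for `k ≤ n` this is `R[t]/(t^k)`
with the `R[n]`-module structure coming from the natural surjection `R[n] → R[k]`). -/
abbrev Rmod (R : Type*) [CommRing R] (n k : ℕ) : Type _ :=
  Rn R n ⧸ (Ideal.span {tn R n ^ k})

/-- The constant term homomorphism `R[n] → R` (for `n > 0`). -/
def ct (R : Type*) [CommRing R] (n : ℕ) (hn : 0 < n) : Rn R n →+* R :=
  Ideal.Quotient.lift _ (evalRingHom 0) (by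
    intro a ha
    rw [Ideal.mem_span_singleton] at ha
    obtain ⟨c, rfl⟩ := ha
    simp [zero_pow hn.ne'])

section Modules

variable (R : Type*) [CommRing R] (n : ℕ) (M : Type*) [AddCommGroup M] [Module (Rn R n) M]

/-- The submodule `M_i = t^i M` of an `R[n]`-module `M`. -/
def tMi (i : ℕ) : Submodule (Rn R n) M :=
  LinearMap.range (LinearMap.lsmul (Rn R n) M (tn R n ^ i))

/-- The submodule `M^{(i)} = {m ∈ M : t^i m = 0}` of an `R[n]`-module `M`. -/
def kt (i : ℕ) : Submodule (Rn R n) M :=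
  LinearMap.ker (LinearMap.lsmul (Rn R n) M (tn R n ^ i))

/-- `G_i(M) = t^i M / t^{i+1} M`. -/
abbrev Gi (i : ℕ) :=
  (tMi R n M i) ⧸ (Submodule.comap (tMi R n M i).subtype (tMi R n M (i + 1)))

/-- `G^{(i+1)}(M) = M^{(i+1)}/M^{(i)}` (note the shift by one in the indexing:
`Gup R n M i` is `G^{(i+1)}(M)`). -/
abbrev Gup (i : ℕ) :=
  (kt R n M (i + 1)) ⧸ (Submodule.comap (kt R n M (i + 1)).subtype (kt R n M i))

lemma tMi_succ_mem {i : ℕ} {x : M} (hx : x ∈ tMi R n M i) :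
    tn R n • x ∈ tMi R n M (i + 1) := by
  obtain ⟨m, rfl⟩ := hx
  exact ⟨m, by simp [LinearMap.lsmul_apply, smul_smul, pow_succ']⟩

lemma kt_pred_mem {i : ℕ} {x : M} (hx : x ∈ kt R n M (i + 1)) :
    tn R n • x ∈ kt R n M i := by
  simp only [kt, LinearMap.mem_ker, LinearMap.lsmul_apply] at hx ⊢
  rw [smul_smul, ← pow_succ]
  exact hx

/-- `μ_i : G_i(M) → G_{i+1}(M)`, induced by multiplication by `t`. -/
def muMap (i : ℕ) : Gi R n M i →ₗ[Rn R n] Gi R n M (i + 1) :=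
  Submodule.mapQ _ _
    (LinearMap.restrict (LinearMap.lsmul (Rn R n) M (tn R n))
      (fun _ hx => tMi_succ_mem R n M hx))
    (fun x hx => by
      simp only [Submodule.mem_comap] at hx ⊢
      exact tMi_succ_mem R n M hx)

/-- `λ_{i+1} : G^{(i+2)}(M) → G^{(i+1)}(M)`, induced by multiplication by `t`
(with the shifted indexing, `lamMap R n M i : Gup (i+1) → Gup i`). -/
def lamMap (i : ℕ) : Gup R n M (i + 1) →ₗ[Rn R n] Gup R n M i :=
  Submodule.mapQ _ _
    (LinearMap.restrict (LinearMap.lsmul (Rn R n) M (tn R n))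
      (fun _ hx => kt_pred_mem R n M hx))
    (fun x hx => by
      simp only [Submodule.mem_comap] at hx ⊢
      exact kt_pred_mem R n M hx)

/-- The composition `μ_{k-1} ∘ ... ∘ μ_0 : G_0(M) → G_k(M)`. -/
def muComp : (k : ℕ) → (Gi R n M 0 →ₗ[Rn R n] Gi R n M k)
  | 0 => LinearMap.id
  | (k + 1) => (muMap R n M k).comp (muComp k)

/-- The composition `λ_1 ∘ ... ∘ λ_k : G^{(k+1)}(M) → G^{(1)}(M)`. -/
def lamComp : (k : ℕ) → (Gup R n M k →ₗ[Rn R n] Gup R n M 0)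
  | 0 => LinearMap.id
  | (k + 1) => (lamComp k).comp (lamMap R n M k)

end Modules

section DoubleLocal

/-- The constant term homomorphism `A = R[2] → R`. -/
def ct2 (R : Type*) [CommRing R] : Rn R 2 →+* R := ct R 2 (by norm_num)

/-- The ideal `I = (t) ⊆ A = R[2]` (the ideal of `X ⊆ X₂` at the point). -/
def It (R : Type*) [CommRing R] : Ideal (Rn R 2) := Ideal.span {tn R 2}

/-- The ideal `𝔪I ⊆ A = R[2]`. -/
def mIt (R : Type*) [CommRing R] [IsLocalRing R] : Ideal (Rn R 2) :=
  Ideal.map (algebraMap R (Rn R 2)) (IsLocalRing.maximalIdeal R) * It R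

/-- The ideal `𝔪²I ⊆ A = R[2]`. -/
def m2It (R : Type*) [CommRing R] [IsLocalRing R] : Ideal (Rn R 2) :=
  (Ideal.map (algebraMap R (Rn R 2)) (IsLocalRing.maximalIdeal R)) ^ 2 * It R

end DoubleLocal

open TensorProduct

universe u

section Regular

variable {R : Type*} [CommRing R] [IsLocalRing R]

open IsLocalRing

lemma exists_chain_of_ringKrullDim_eq_two (hdim : ringKrullDim R = 2) :
    ∃ p q : Ideal R, p.IsPrime ∧ q.IsPrime ∧ p < q ∧ q < maximalIdeal R := by
  obtain ⟨l, hl⟩ := (Order.le_krullDim_iff (α := PrimeSpectrum R) (n := 2)).1 hdim.ge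
  have h01 : l ⟨0, by omega⟩ < l ⟨1, by omega⟩ := l.strictMono (by simp [Fin.lt_def])
  have h12 : l ⟨1, by omega⟩ < l ⟨2, by omega⟩ := l.strictMono (by simp [Fin.lt_def])
  exact ⟨_, _, (l ⟨0, by omega⟩).2, (l ⟨1, by omega⟩).2, h01,
    lt_of_lt_of_le h12 (le_maximalIdeal (l ⟨2, by omega⟩).2.ne_top)⟩

variable [IsNoetherianRing R]

lemma not_mem_minimalPrimes_sup_span_of_lt {p q : Ideal R} (hp : p.IsPrime) (hq : q.IsPrime)
    (hpq : p < q) (hqm : q < maximalIdeal R) (a : R) :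
    maximalIdeal R ∉ (p ⊔ Ideal.span {a}).minimalPrimes := by
  intro h
  have hle := Ideal.map_height_le_one_of_mem_minimalPrimes h
  set f := Ideal.Quotient.mk p
  have hf : Function.Surjective f := Ideal.Quotient.mk_surjective
  have hker : RingHom.ker f = p := Ideal.mk_ker
  have hqP : (q.map f).IsPrime := Ideal.map_isPrime_of_surjective hf (by rw [hker]; exact hpq.le)
  have hmP : ((maximalIdeal R).map f).IsPrime :=
    Ideal.map_isPrime_of_surjective hf (by rw [hker]; exact (hpq.trans hqm).le)
  have hc : ∀ {J : Ideal R}, p ≤ J → (J.map f).comap f = J := fun {J} hJ => by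
    rw [Ideal.comap_map_of_surjective f hf, ← RingHom.ker_eq_comap_bot, hker, sup_eq_left.2 hJ]
  have h1 : q.map f < (maximalIdeal R).map f := by
    refine lt_of_le_of_ne (Ideal.map_mono hqm.le) fun e => hqm.ne ?_
    rw [← hc hpq.le, e, hc (hpq.trans hqm).le]
  have h0 : (⊥ : Ideal (R ⧸ p)) < q.map f := by
    refine lt_of_le_of_ne bot_le fun e => hpq.ne ?_
    rw [← hc hpq.le, ← e, ← RingHom.ker_eq_comap_bot, hker]
  have hbP : (⊥ : Ideal (R ⧸ p)).IsPrime := Ideal.isPrime_bot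
  have e0 := Ideal.height_strict_mono_of_isPrime_of_isPrime h0
  have e1 := (Ideal.height_strict_mono_of_isPrime_of_isPrime h1).trans_le hle
  exact not_lt_bot ((Order.lt_one_iff.1 e1) ▸ e0)

/-- Let `m = (a, b)`; every element outside `(a)` is, modulo `(a)`, a unit times a power of `b`. -/
lemma exists_unit_mul_pow_sub_mem {a b : R} (hm : maximalIdeal R = Ideal.span {a, b}) {x : R}
    (hx : x ∉ Ideal.span {a}) : ∃ (u : Rˣ) (n : ℕ), x - u * b ^ n ∈ Ideal.span {a} := by
  have hH : ∃ n, x ∉ Ideal.span {a} ⊔ Ideal.span {b ^ n} := by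
    by_contra! h
    apply hx
    have key := Ideal.iInf_pow_smul_eq_bot_of_isLocalRing (M := R ⧸ Ideal.span {a})
      (Ideal.span {b}) (ne_top_of_le_ne_top (maximalIdeal.isMaximal R).ne_top
        (hm ▸ Ideal.span_mono (by simp)))
    rw [← Ideal.Quotient.eq_zero_iff_mem, ← Submodule.mem_bot R, ← key, Submodule.mem_iInf]
    intro i
    obtain ⟨y, hy, z, hz, hyz⟩ := Submodule.mem_sup.1 (h i)
    obtain ⟨w, rfl⟩ := Ideal.mem_span_singleton.1 hz
    rw [← hyz, map_add, Ideal.Quotient.eq_zero_iff_mem.2 hy, zero_add]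
    exact Submodule.smul_mem_smul (Ideal.pow_mem_pow (Ideal.mem_span_singleton_self b) i)
      (Submodule.mem_top (x := Ideal.Quotient.mk _ w))
  classical
  have hn := Nat.find_spec hH
  obtain ⟨k, hk⟩ : ∃ k, Nat.find hH = k + 1 := Nat.exists_eq_succ_of_ne_zero fun h0 => by
    rw [h0] at hn; simp at hn
  have hlt := Nat.find_min hH (m := k) (by omega)
  rw [hk] at hn
  rw [not_not] at hlt
  obtain ⟨y, hy, z, hz, hyz⟩ := Submodule.mem_sup.1 hlt
  obtain ⟨w, rfl⟩ := Ideal.mem_span_singleton.1 hz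
  have hw : IsUnit w := by
    by_contra hw
    have hw' : w ∈ maximalIdeal R := hw
    rw [hm, Ideal.mem_span_pair] at hw'
    obtain ⟨c, d, rfl⟩ := hw'
    apply hn
    rw [← hyz]
    refine Submodule.mem_sup.2 ⟨y + b ^ k * c * a,
      add_mem hy (Ideal.mem_span_singleton.2 ⟨b ^ k * c, by ring⟩),
      b ^ (k + 1) * d, Ideal.mem_span_singleton.2 ⟨d, rfl⟩, by ring⟩
  obtain ⟨u, rfl⟩ := hw
  refine ⟨u, k, ?_⟩
  rw [← hyz]
  convert hy using 1
  ring

/-- In a two-dimensional local ring with maximal ideal `(a, b)`, the pair `a, b` is a regular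
sequence. -/
lemma regular_pair_of_ringKrullDim_eq_two (hdim : ringKrullDim R = 2) {a b : R}
    (hm : maximalIdeal R = Ideal.span {a, b}) :
    (∀ x, a * x = 0 → x = 0) ∧ ∀ y, b * y ∈ Ideal.span {a} → y ∈ Ideal.span {a} := by
  obtain ⟨p, q, hp, hq, hpq, hqm⟩ := exists_chain_of_ringKrullDim_eq_two hdim
  have ham : a ∈ maximalIdeal R := hm ▸ Ideal.subset_span (by simp)
  have hbn : ∀ n, b ^ n ∉ p ⊔ Ideal.span {a} := fun n hn =>
    not_mem_minimalPrimes_sup_span_of_lt hp hq hpq hqm a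
      ⟨⟨inferInstance, sup_le (hpq.trans hqm).le ((Ideal.span_singleton_le_iff_mem _).2 ham)⟩,
        fun r hr _ => by
          have hr1 := hr.1
          rw [hm, Ideal.span_le]
          rintro x (rfl | rfl)
          · exact hr.2 (Ideal.mem_sup_right (Ideal.mem_span_singleton_self _))
          · exact hr1.mem_of_pow_mem n (hr.2 hn)⟩
  have hbn' : ∀ (u : Rˣ) n, (u : R) * b ^ n ∉ p ⊔ Ideal.span {a} := fun u n h =>
    hbn n ((Ideal.unit_mul_mem_iff_mem _ u.isUnit).1 h)
  have hpa : p ≤ Ideal.span {a} := fun x hx => by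
    by_contra hxa
    obtain ⟨u, n, h⟩ := exists_unit_mul_pow_sub_mem hm hxa
    apply hbn' u n
    rw [← sub_sub_cancel x (u * b ^ n : R)]
    exact sub_mem (Ideal.mem_sup_left hx) (Ideal.mem_sup_right h)
  have hap : a ∉ p := fun h => by
    obtain ⟨x, hxq, hxp⟩ := SetLike.exists_of_lt hpq
    have hle := (Ideal.span_singleton_le_iff_mem _).2 h
    obtain ⟨u, n, h'⟩ := exists_unit_mul_pow_sub_mem hm (fun hx => hxp (hle hx))
    have hbq : b ^ n ∈ q := by
      rw [← Ideal.unit_mul_mem_iff_mem _ u.isUnit, ← sub_sub_cancel x (u * b ^ n : R)]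
      exact sub_mem hxq (hpq.le (hle h'))
    refine hqm.not_ge ?_
    rw [hm, Ideal.span_le]
    rintro x (rfl | rfl)
    · exact hpq.le h
    · exact hq.mem_of_pow_mem n hbq
  have hp0 : p = ⊥ := by
    refine Submodule.eq_bot_of_le_smul_of_le_jacobson_bot (maximalIdeal R) p
      (IsNoetherian.noetherian p) (fun x hx => ?_) (maximalIdeal_le_jacobson _)
    obtain ⟨y, rfl⟩ := Ideal.mem_span_singleton.1 (hpa hx)
    exact Submodule.smul_mem_smul ham ((hp.mem_or_mem hx).resolve_left hap)
  subst hp0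
  refine ⟨fun x hx => ((hp.mem_or_mem (show a * x ∈ (⊥ : Ideal R) from hx)).resolve_left hap),
    fun y hy => ?_⟩
  by_contra hya
  obtain ⟨u, n, h⟩ := exists_unit_mul_pow_sub_mem hm hya
  apply hbn' u (n + 1)
  rw [← sub_sub_cancel (b * y) (u * b ^ (n + 1) : R)]
  refine sub_mem (Ideal.mem_sup_right hy) (Ideal.mem_sup_right ?_)
  convert Ideal.mul_mem_left _ b h using 1
  ring

lemma exists_syzygy_of_ringKrullDim_eq_two (hdim : ringKrullDim R = 2) {a b : R}
    (hm : maximalIdeal R = Ideal.span {a, b}) {x y : R} (h : x * a + y * b = 0) :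
    ∃ c, x = c * b ∧ y = -(c * a) := by
  obtain ⟨ha, hb⟩ := regular_pair_of_ringKrullDim_eq_two hdim hm
  obtain ⟨c, rfl⟩ := Ideal.mem_span_singleton.1
    (hb y (Ideal.mem_span_singleton.2 ⟨-x, by linear_combination h⟩))
  refine ⟨-c, ?_, by ring⟩
  rw [← sub_eq_zero]
  exact ha _ (by linear_combination h)

end Regular

section Homological

open CategoryTheory

section

open Limits Projective

variable {C : Type*} [Category* C] [Abelian C] [EnoughProjectives C]
  {X₁ X₀ : C} (d : X₁ ⟶ X₀)

lemma Projective.d_comp (f : X₁ ⟶ X₀) : Projective.d f ≫ f = 0 :=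
  (Category.assoc (Projective.π _) (kernel.ι f) f).trans
    ((congrArg _ (kernel.condition f)).trans comp_zero)

/-- The chain complex extending `d : X₁ ⟶ X₀` by successive projective covers of kernels. -/
noncomputable def presentationComplex : ChainComplex C ℕ :=
  ChainComplex.mk' X₀ X₁ d (fun f => ⟨_, Projective.d f, Projective.d_comp f⟩)

/-- The higher terms of `presentationComplex d` are projective covers of kernels. -/
noncomputable def presentationComplexXIso (n : ℕ) :
    (presentationComplex d).X (n + 2) ≅ syzygies ((presentationComplex d).d (n + 1) n) :=
  ChainComplex.mk'XIso X₀ X₁ d (fun f => ⟨_, Projective.d f, Projective.d_comp f⟩) n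

lemma presentationComplexXIso_hom_comp_d (n : ℕ) :
    (presentationComplexXIso d n).hom ≫ Projective.d ((presentationComplex d).d (n + 1) n) =
      (presentationComplex d).d (n + 2) (n + 1) :=
  (ChainComplex.mk'_d X₀ X₁ d (fun f => ⟨_, Projective.d f, Projective.d_comp f⟩) n).symm

lemma presentationComplex_d_1_0 : (presentationComplex d).d 1 0 = d :=
  ChainComplex.mk'_d_1_0 ..

lemma presentationComplex_exactAt_succ (n : ℕ) :
    (presentationComplex d).ExactAt (n + 1) := by
  rw [HomologicalComplex.exactAt_iff' _ (n + 2) (n + 1) n (by simp) (by simp)]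
  let e : (presentationComplex d).sc' (n + 2) (n + 1) n ≅
      ShortComplex.mk _ ((presentationComplex d).d (n + 1) n) (Projective.d_comp _) :=
    ShortComplex.isoMk (presentationComplexXIso d n) (Iso.refl _) (Iso.refl _)
      ((presentationComplexXIso_hom_comp_d d n).trans (Category.comp_id _).symm)
      ((Category.id_comp _).trans (Category.comp_id _).symm)
  exact ShortComplex.exact_of_iso e.symm (exact_d_f _)

lemma presentationComplex_projective [Projective X₀] [Projective X₁] :
    ∀ n, Projective ((presentationComplex d).X n)
  | 0 => ‹Projective X₀›
  | 1 => ‹Projective X₁›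
  | n + 2 => Projective.of_iso (presentationComplexXIso d n).symm (projective_over _)

/-- A projective presentation `X₁ ⟶ X₀ ⟶ Z` extends to a projective resolution of `Z`. -/
noncomputable def presentationResolution [Projective X₀] [Projective X₁] {Z : C} (π : X₀ ⟶ Z)
    [Epi π] (w : d ≫ π = 0) (h : (ShortComplex.mk d π w).Exact) : ProjectiveResolution Z where
  complex := presentationComplex d
  projective := presentationComplex_projective d
  π := (ChainComplex.toSingle₀Equiv _ _).symm ⟨π, by rw [presentationComplex_d_1_0]; exact w⟩
  quasiIso := ⟨fun n => by
    cases n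
    · rw [ChainComplex.quasiIsoAt₀_iff, ShortComplex.quasiIso_iff_of_zeros']
      · refine (ShortComplex.exact_and_epi_g_iff_of_iso ?_).2 ⟨h, ‹Epi π›⟩
        refine ShortComplex.isoMk (Iso.refl _) (Iso.refl _) (Iso.refl _) ?_ ?_
        · exact ((Category.id_comp _).trans (presentationComplex_d_1_0 d).symm).trans
            (Category.comp_id _).symm
        · refine ((Category.id_comp _).trans (Eq.symm ?_)).trans (Category.comp_id _).symm
          exact ChainComplex.toSingle₀Equiv_symm_apply_f_zero (C := presentationComplex d) π _
      all_goals rfl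
    · rw [quasiIsoAt_iff_exactAt']
      · apply presentationComplex_exactAt_succ
      · apply ChainComplex.exactAt_succ_single_obj⟩

end

variable {A : Type u} [CommRing A] {M N F₀ F₁ : Type u} [AddCommGroup M] [AddCommGroup N]
  [AddCommGroup F₀] [AddCommGroup F₁] [Module A M] [Module A N] [Module A F₀] [Module A F₁]

variable (N) in
/-- Linear maps `F₁ → N` vanishing on the kernel of `d`. -/
def kerAnnihilator (d : F₁ →ₗ[A] F₀) : Submodule A (F₁ →ₗ[A] N) :=
  LinearMap.ker (LinearMap.lcomp A N (LinearMap.ker d).subtype)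

variable (N) in
/-- Linear maps `F₁ → N` vanishing on the kernel of `d` that factor through `d`. -/
def precompRange (d : F₁ →ₗ[A] F₀) : Submodule A (kerAnnihilator N d) :=
  (LinearMap.range (LinearMap.lcomp A N d)).comap (kerAnnihilator N d).subtype

lemma mem_kerAnnihilator {d : F₁ →ₗ[A] F₀} {φ : F₁ →ₗ[A] N} :
    φ ∈ kerAnnihilator N d ↔ ∀ x, d x = 0 → φ x = 0 := by
  simp [kerAnnihilator, LinearMap.ext_iff]

lemma nonempty_ext_one_equiv [Module.Projective A F₀] [Module.Projective A F₁]
    (d : F₁ →ₗ[A] F₀) (π : F₀ →ₗ[A] M) (hπ : Function.Surjective π) (hd : Function.Exact d π) :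
    Nonempty (((Ext A (ModuleCat.{u} A) 1).obj (Opposite.op (ModuleCat.of A M))).obj
      (ModuleCat.of A N) ≃ₗ[A] kerAnnihilator N d ⧸ precompRange N d) := by
  have : Projective (ModuleCat.of A F₀) := inferInstance
  have : Projective (ModuleCat.of A F₁) := inferInstance
  have : Epi (ModuleCat.ofHom π) := (ModuleCat.epi_iff_surjective _).2 hπ
  have w : ModuleCat.ofHom d ≫ ModuleCat.ofHom π = 0 := by
    ext x; exact hd.apply_apply_eq_zero x
  let P := presentationResolution (ModuleCat.ofHom d) (ModuleCat.ofHom π) w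
    ((ShortComplex.ShortExact.moduleCat_exact_iff_function_exact _).2 hd)
  let K := P.complex.linearYonedaObj A (ModuleCat.of A N)
  have e : K.homology 1 ≅ _ :=
    ShortComplex.homologyMapIso (K.isoSc' 0 1 2 (by simp) (by simp)) ≪≫
      (K.sc' 0 1 2).moduleCatHomologyIso
  have h10 : P.complex.d 1 0 = ModuleCat.ofHom d := presentationComplex_d_1_0 _
  have h10' : ∀ x : F₁, d x = (P.complex.d 1 0).hom x :=
    fun x => (congrArg (fun k => k.hom x) h10).symm
  have hex : (P.complex.sc' 2 1 0).Exact :=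
    (HomologicalComplex.exactAt_iff' _ 2 1 0 (by simp) (by simp)).1
      (presentationComplex_exactAt_succ (ModuleCat.ofHom d) 0)
  rw [ShortComplex.moduleCat_exact_iff] at hex
  refine ⟨(P.isoExt 1 (ModuleCat.of A N) ≪≫ e).toLinearEquiv ≪≫ₗ ?_⟩
  let E : (K.sc' 0 1 2).X₂ ≃ₗ[A] (F₁ →ₗ[A] N) :=
    ModuleCat.homLinearEquiv (M := ModuleCat.of A F₁) (N := ModuleCat.of A N) (S := A)
  have hg : ∀ φ : (K.sc' 0 1 2).X₂, (K.sc' 0 1 2).g φ = 0 ↔ ∀ x, d x = 0 → E φ x = 0 := by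
    intro φ
    have h1 : (K.sc' 0 1 2).g φ = 0 ↔ P.complex.d 2 1 ≫ (show P.complex.X 1 ⟶ _ from φ) = 0 :=
      Iff.rfl
    rw [h1]
    constructor
    · intro h x hx
      obtain ⟨y, rfl⟩ := hex x ((h10' x).symm.trans hx)
      exact congrArg (fun k => k.hom y) h
    · intro h
      ext y
      refine h _ ?_
      exact (h10' _).trans (congrArg (fun k => k.hom y) (P.complex.d_comp_d 2 1 0))
  have hf : ∀ ψ : F₀ →ₗ[A] N,
      (K.sc' 0 1 2).f (ModuleCat.ofHom ψ : ModuleCat.of A F₀ ⟶ _) = E.symm (ψ.comp d) := by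
    intro ψ
    change P.complex.d 1 0 ≫ _ = _
    exact congrArg (fun k => k ≫ ModuleCat.ofHom ψ) h10
  have hE : (LinearMap.ker (K.sc' 0 1 2).g.hom).map (E : _ →ₗ[A] _) = kerAnnihilator N d := by
    ext φ
    rw [Submodule.mem_map_equiv, LinearMap.mem_ker, mem_kerAnnihilator, hg]
    simp
  refine Submodule.Quotient.equiv _ _ (E.ofSubmodules _ _ hE) ?_
  ext ⟨φ, hφ⟩
  rw [Submodule.mem_map_equiv]
  constructor
  · rintro ⟨ψ, hψ⟩
    refine ⟨ModuleCat.Hom.hom (show ModuleCat.of A F₀ ⟶ ModuleCat.of A N from ψ), ?_⟩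
    exact (E.eq_symm_apply.1 ((congrArg Subtype.val hψ).symm.trans (hf _))).symm
  · rintro ⟨ψ, hψ⟩
    refine ⟨(ModuleCat.ofHom ψ : ModuleCat.of A F₀ ⟶ ModuleCat.of A N), Subtype.ext ?_⟩
    exact (hf ψ).trans (congrArg E.symm hψ)

end Homological

section DualNumbers

variable {R A : Type u} [CommRing R] [CommRing A] [Algebra R A]

/-- `A` is free over `R` with basis `1, t`, where `t² = 0`. -/
structure IsDualNumbers (R : Type*) {A : Type*} [CommRing R] [CommRing A] [Algebra R A] (t : A) :
    Prop where
  mul_self : t * t = 0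
  exists_eq : ∀ x : A, ∃ r s : R, x = algebraMap R A r + algebraMap R A s * t
  eq_zero : ∀ r s : R, algebraMap R A r + algebraMap R A s * t = 0 → r = 0 ∧ s = 0

lemma IsDualNumbers.smul_eq {t : A} {M : Type*} [AddCommGroup M] [Module R M] [Module A M]
    [IsScalarTower R A M] (htM : ∀ x : M, t • x = 0) (r s : R) (x : M) :
    (algebraMap R A r + algebraMap R A s * t) • x = r • x := by
  rw [add_smul, mul_smul, htM, smul_zero, add_zero, algebraMap_smul]

/-- The relations `(b, -a)`, `(t, 0)`, `(0, t)` of the generators `a, b` of an ideal killed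
by `t`. -/
def pairRelations (t : A) (a b : R) : A × A × A →ₗ[A] A × A :=
  (LinearMap.toSpanSingleton A (A × A) (algebraMap R A b, -algebraMap R A a)).coprod
    ((LinearMap.toSpanSingleton A (A × A) (t, 0)).coprod
      (LinearMap.toSpanSingleton A (A × A) (0, t)))

lemma pairRelations_apply (t : A) (a b : R) (x y z : A) :
    pairRelations t a b (x, y, z) =
      (x * algebraMap R A b + y * t, -(x * algebraMap R A a) + z * t) := by
  simp [pairRelations]

/-- The linear map `A² → M` with values `x`, `y` on the basis. -/
def pairMap (A : Type*) [CommRing A] {M : Type*} [AddCommGroup M] [Module A M] (x y : M) :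
    A × A →ₗ[A] M :=
  (LinearMap.toSpanSingleton A M x).coprod (LinearMap.toSpanSingleton A M y)

@[simp]
lemma pairMap_apply {M : Type*} [AddCommGroup M] [Module A M] (x y : M) (p : A × A) :
    pairMap A x y p = p.1 • x + p.2 • y := by
  simp [pairMap]

/-- The linear map `A³ → M` with values `x`, `y`, `z` on the basis. -/
def tripleMap (A : Type*) [CommRing A] {M : Type*} [AddCommGroup M] [Module A M] (x y z : M) :
    A × A × A →ₗ[A] M :=
  (LinearMap.toSpanSingleton A M x).coprod (pairMap A y z)

@[simp]
lemma tripleMap_apply {M : Type*} [AddCommGroup M] [Module A M] (x y z : M) (p : A × A × A) :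
    tripleMap A x y z p = p.1 • x + (p.2.1 • y + p.2.2 • z) := by
  simp [tripleMap]

lemma eq_pairMap {M : Type*} [AddCommGroup M] [Module A M] (f : A × A →ₗ[A] M) :
    f = pairMap A (f (1, 0)) (f (0, 1)) := by
  ext <;> simp

lemma eq_tripleMap {M : Type*} [AddCommGroup M] [Module A M] (f : A × A × A →ₗ[A] M) :
    f = tripleMap A (f (1, 0, 0)) (f (0, 1, 0)) (f (0, 0, 1)) := by
  ext
  · simp only [LinearMap.comp_apply, LinearMap.inl_apply, tripleMap_apply]
    simp [← Prod.zero_eq_mk]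
  all_goals simp

lemma tripleMap_injective {M : Type*} [AddCommGroup M] [Module A M] {x y z x' y' z' : M} :
    tripleMap A x y z = tripleMap A x' y' z' ↔ x = x' ∧ y = y' ∧ z = z' := by
  refine ⟨fun h => ⟨?_, ?_, ?_⟩, by rintro ⟨rfl, rfl, rfl⟩; rfl⟩
  · simpa using LinearMap.congr_fun h (1, 0, 0)
  · simpa using LinearMap.congr_fun h (0, 1, 0)
  · simpa using LinearMap.congr_fun h (0, 0, 1)

lemma pairMap_comp_pairRelations {t : A} (a b : R) {M : Type*} [AddCommGroup M] [Module R M]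
    [Module A M] [IsScalarTower R A M] (htM : ∀ x : M, t • x = 0) (x y : M) :
    (pairMap A x y).comp (pairRelations t a b) = tripleMap A (b • x - a • y) 0 0 := by
  refine LinearMap.ext fun ⟨p, q, r⟩ => ?_
  simp [pairRelations_apply, htM, add_smul, mul_smul, sub_eq_add_neg]

variable {t : A} {a b : R} {J : Ideal R}

section

variable [Module A J] [IsScalarTower R A J]

lemma pairMap_surjective (hJ : J = Ideal.span {a, b}) (ha : a ∈ J) (hb : b ∈ J) :
    Function.Surjective (pairMap A (⟨a, ha⟩ : J) ⟨b, hb⟩) := by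
  rintro ⟨x, hx⟩
  obtain ⟨r, s, rfl⟩ := Ideal.mem_span_pair.1 (hJ ▸ hx)
  exact ⟨(algebraMap R A r, algebraMap R A s), Subtype.ext (by simp)⟩

lemma pairRelations_exact (ht : IsDualNumbers R t) (htJ : ∀ x : J, t • x = 0)
    (hab : ∀ x y : R, x * a + y * b = 0 → ∃ c, x = c * b ∧ y = -(c * a)) (ha : a ∈ J)
    (hb : b ∈ J) :
    Function.Exact (pairRelations t a b) (pairMap A (⟨a, ha⟩ : J) ⟨b, hb⟩) := by
  rintro ⟨x, y⟩
  constructor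
  · intro h
    obtain ⟨r, s, rfl⟩ := ht.exists_eq x
    obtain ⟨r', s', rfl⟩ := ht.exists_eq y
    simp only [pairMap_apply, IsDualNumbers.smul_eq htJ] at h
    obtain ⟨c, rfl, rfl⟩ := hab r r' (by simpa using congrArg Subtype.val h)
    exact ⟨(algebraMap R A c, algebraMap R A s, algebraMap R A s'), by
      simp [pairRelations_apply]⟩
  · rintro ⟨⟨p, q, r⟩, h⟩
    rw [← h, ← LinearMap.comp_apply, pairMap_comp_pairRelations a b htJ]
    have : b • (⟨a, ha⟩ : J) - a • ⟨b, hb⟩ = 0 := Subtype.ext (by simp [mul_comm])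
    rw [this]
    simp

end

variable {N : Type u} [AddCommGroup N] [Module R N] [Module A N] [IsScalarTower R A N]

lemma tripleMap_mem_kerAnnihilator_iff (ht : IsDualNumbers R t) (htN : ∀ x : N, t • x = 0)
    (ha : ∀ x : R, a * x = 0 → x = 0) {x y z : N} :
    tripleMap A x y z ∈ kerAnnihilator N (pairRelations t a b) ↔ b • y = a • z := by
  rw [mem_kerAnnihilator]
  constructor
  · intro h
    have := h (t, -algebraMap R A b, algebraMap R A a)
      (by rw [pairRelations_apply]; ext <;> simp <;> ring)
    simp only [tripleMap_apply, htN, neg_smul, algebraMap_smul, zero_add] at this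
    rw [← sub_eq_zero, ← neg_eq_zero, ← this]
    abel
  · rintro h ⟨p, q, r⟩ hpqr
    obtain ⟨p, p', rfl⟩ := ht.exists_eq p
    obtain ⟨q, q', rfl⟩ := ht.exists_eq q
    obtain ⟨r, r', rfl⟩ := ht.exists_eq r
    rw [pairRelations_apply, Prod.mk_eq_zero] at hpqr
    obtain ⟨h1, h2⟩ := hpqr
    have tt := ht.mul_self
    obtain ⟨-, hq⟩ := ht.eq_zero (p * b) (p' * b + q) (by
      simp only [map_mul, map_add]
      linear_combination h1 - algebraMap R A q' * tt)
    obtain ⟨hp, hr⟩ := ht.eq_zero (-(a * p)) (-(p' * a) + r) (by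
      simp only [map_mul, map_add, map_neg]
      linear_combination h2 - algebraMap R A r' * tt)
    obtain rfl := ha p (neg_eq_zero.1 hp)
    obtain rfl : q = -(p' * b) := by linear_combination hq
    obtain rfl : r = p' * a := by linear_combination hr
    simp only [tripleMap_apply, IsDualNumbers.smul_eq htN, zero_smul, zero_add, neg_smul, mul_smul,
      h, neg_add_cancel]

/-- Two surjections with the same kernel have isomorphic targets. -/
lemma nonempty_equiv_of_ker_eq {P Q S : Type*} [AddCommGroup P] [AddCommGroup Q] [AddCommGroup S]
    [Module R P] [Module R Q] [Module R S] (f : P →ₗ[R] Q) (g : P →ₗ[R] S)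
    (hf : Function.Surjective f) (hg : Function.Surjective g)
    (h : LinearMap.ker f = LinearMap.ker g) : Nonempty (Q ≃ₗ[R] S) :=
  ⟨(f.quotKerEquivOfSurjective hf).symm ≪≫ₗ Submodule.quotEquivOfEq _ _ h ≪≫ₗ
    g.quotKerEquivOfSurjective hg⟩

/-- The cocycle attached to `x ∈ J` and `c ∈ R`. -/
def pairCocycle (ht : IsDualNumbers R t) (htN : ∀ x : N, t • x = 0)
    (hreg : ∀ x : R, a * x = 0 → x = 0) (ha : a ∈ J) (hb : b ∈ J) (e : N ≃ₗ[R] J) :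
    J × R →ₗ[R] kerAnnihilator N (pairRelations t a b) where
  toFun p := ⟨tripleMap A (e.symm p.1) (p.2 • e.symm ⟨a, ha⟩) (p.2 • e.symm ⟨b, hb⟩), by
    rw [tripleMap_mem_kerAnnihilator_iff ht htN hreg]
    apply e.injective
    simp only [map_smul, e.apply_symm_apply]
    exact Subtype.ext (by simp; ring)⟩
  map_add' p q := Subtype.ext <| by ext <;> simp [add_smul]
  map_smul' r p := Subtype.ext <| by ext <;> simp [mul_smul]

lemma nonempty_quotient_equiv (ht : IsDualNumbers R t) (htN : ∀ x : N, t • x = 0)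
    (hJ : J = Ideal.span {a, b}) (hreg : ∀ x : R, a * x = 0 → x = 0)
    (hab : ∀ x y : R, x * a + y * b = 0 → ∃ c, x = c * b ∧ y = -(c * a)) (e : N ≃ₗ[R] J) :
    Nonempty ((kerAnnihilator N (pairRelations t a b) ⧸ precompRange N (pairRelations t a b)) ≃ₗ[R]
      (J ⧸ Submodule.comap J.subtype (J ^ 2)) × R) := by
  have ha : a ∈ J := hJ ▸ Ideal.subset_span (by simp)
  have hb : b ∈ J := hJ ▸ Ideal.subset_span (by simp)
  refine nonempty_equiv_of_ker_eq
    (((precompRange N (pairRelations t a b)).mkQ.restrictScalars R).comp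
      (pairCocycle ht htN hreg ha hb e))
    ((Submodule.mkQ _).prodMap LinearMap.id)
    ((Submodule.mkQ_surjective _).comp ?_)
    (Function.Surjective.prodMap (Submodule.mkQ_surjective _) Function.surjective_id) ?_
  · rintro ⟨φ, hφ⟩
    rw [eq_tripleMap φ] at hφ
    have h := (tripleMap_mem_kerAnnihilator_iff ht htN hreg).1 hφ
    have h' : b * (e (φ (0, 1, 0)) : R) = a * (e (φ (0, 0, 1)) : R) := by
      simpa using congrArg (fun n => (e n : R)) h
    obtain ⟨c, h1, h2⟩ := hab (-(e (φ (0, 0, 1)) : R)) (e (φ (0, 1, 0)) : R)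
      (by linear_combination h')
    refine ⟨(e (φ (1, 0, 0)), -c), Subtype.ext (Eq.trans ?_ (eq_tripleMap φ).symm)⟩
    refine tripleMap_injective.2 ⟨e.symm_apply_apply _, ?_, ?_⟩
    · apply e.injective
      rw [map_smul, e.apply_symm_apply]
      exact Subtype.ext (by simp [h2])
    · apply e.injective
      rw [map_smul, e.apply_symm_apply]
      exact Subtype.ext (by simp [neg_eq_iff_eq_neg.1 h1])
  · ext ⟨x, c⟩
    have hl : (x, c) ∈ LinearMap.ker
        (((precompRange N (pairRelations t a b)).mkQ.restrictScalars R).comp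
          (pairCocycle ht htN hreg ha hb e)) ↔
        ∃ u v : N, x = e (b • u - a • v) ∧ c = 0 := by
      rw [LinearMap.mem_ker]
      refine (Submodule.Quotient.mk_eq_zero _).trans ⟨?_, ?_⟩
      · rintro ⟨ψ, hψ⟩
        rw [eq_pairMap ψ] at hψ
        replace hψ := (pairMap_comp_pairRelations a b htN _ _).symm.trans hψ
        obtain ⟨h1, h2, -⟩ := tripleMap_injective.1 hψ
        refine ⟨_, _, (e.eq_symm_apply.1 h1).symm, hreg c ?_⟩
        rw [← map_smul, eq_comm, LinearEquiv.map_eq_zero_iff] at h2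
        simpa [mul_comm] using congrArg Subtype.val h2
      · rintro ⟨u, v, rfl, rfl⟩
        refine ⟨pairMap A u v, ?_⟩
        refine (pairMap_comp_pairRelations a b htN u v).trans
          (tripleMap_injective.2 ⟨(e.symm_apply_apply _).symm, ?_, ?_⟩) <;> simp
    have hsq : ∀ x : J, (x : R) ∈ J ^ 2 ↔ ∃ u v : J, (x : R) = u * a + v * b := by
      intro x
      rw [pow_two]
      nth_rw 1 [hJ]
      rw [Ideal.span_insert, Ideal.sup_mul, Submodule.mem_sup]
      simp only [Ideal.mem_span_singleton_mul]
      constructor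
      · rintro ⟨_, ⟨u, hu, rfl⟩, _, ⟨v, hv, rfl⟩, h⟩
        exact ⟨⟨u, hu⟩, ⟨v, hv⟩, by rw [← h]; ring⟩
      · rintro ⟨u, v, h⟩
        exact ⟨_, ⟨u, u.2, rfl⟩, _, ⟨v, v.2, rfl⟩, by rw [h]; ring⟩
    rw [hl, LinearMap.mem_ker]
    simp only [LinearMap.prodMap_apply, Prod.mk_eq_zero, LinearMap.id_apply, Submodule.mkQ_apply,
      Submodule.Quotient.mk_eq_zero, Submodule.mem_comap, Submodule.subtype_apply, hsq]
    constructor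
    · rintro ⟨u, v, rfl, rfl⟩
      exact ⟨⟨-e v, e u, by simp; ring⟩, rfl⟩
    · rintro ⟨⟨u, v, h⟩, rfl⟩
      exact ⟨e.symm v, -e.symm u, Subtype.ext (by simp [h]; ring), rfl⟩

/-- For an ideal `J` generated by a regular sequence, regarded as a module over the dual numbers
`A` of `R` on which `t` acts as zero, `Ext¹_A(J, J) ≅ J/J² × R`. -/
lemma exists_ext_one_addEquiv [Module A J] [IsScalarTower R A J]
    (ht : IsDualNumbers R t) (htJ : ∀ x : J, t • x = 0) (htN : ∀ x : N, t • x = 0)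
    (hJ : J = Ideal.span {a, b}) (hreg : ∀ x : R, a * x = 0 → x = 0)
    (hab : ∀ x y : R, x * a + y * b = 0 → ∃ c, x = c * b ∧ y = -(c * a)) (e : N ≃ₗ[R] J) :
    ∃ E : ((Ext A (ModuleCat.{u} A) 1).obj (Opposite.op (ModuleCat.of A J))).obj
        (ModuleCat.of A N) ≃+ (J ⧸ Submodule.comap J.subtype (J ^ 2)) × R,
      ∀ (r : R) x, E (algebraMap R A r • x) = r • E x := by
  have ha : a ∈ J := hJ ▸ Ideal.subset_span (by simp)
  have hb : b ∈ J := hJ ▸ Ideal.subset_span (by simp)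
  obtain ⟨E₁⟩ := nonempty_ext_one_equiv (N := N) (pairRelations t a b)
    (pairMap A (⟨a, ha⟩ : J) ⟨b, hb⟩) (pairMap_surjective hJ ha hb)
    (pairRelations_exact ht htJ hab ha hb)
  obtain ⟨E₂⟩ := nonempty_quotient_equiv ht htN hJ hreg hab e
  refine ⟨E₁.toAddEquiv.trans E₂.toAddEquiv, fun r x => ?_⟩
  change E₂ (E₁ _) = r • E₂ (E₁ x)
  rw [map_smul, algebraMap_smul, map_smul]

end DualNumbers

lemma isScalarTower_compHom {R A M : Type*} [CommRing R] [CommRing A] [Algebra R A]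
    [AddCommGroup M] [Module R M] (f : A →+* R) (hf : ∀ r, f (algebraMap R A r) = r) :
    letI : Module A M := Module.compHom M f
    IsScalarTower R A M :=
  letI : Module A M := Module.compHom M f
  IsScalarTower.of_algebraMap_smul fun r x => by
    change f (algebraMap R A r) • x = r • x
    rw [hf]

section DoubleStructure

variable (R : Type*) [CommRing R]

lemma isDualNumbers_tn : IsDualNumbers R (tn R 2) where
  mul_self := by
    rw [tn, ← map_mul, Ideal.Quotient.eq_zero_iff_mem, Ideal.mem_span_singleton, pow_two]
  exists_eq x := by
    obtain ⟨f, rfl⟩ := Ideal.Quotient.mk_surjective x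
    refine ⟨f.coeff 0, f.divX.coeff 0, ?_⟩
    change _ = Ideal.Quotient.mk _ (C _) + Ideal.Quotient.mk _ (C _) * Ideal.Quotient.mk _ X
    rw [← map_mul, ← map_add, Ideal.Quotient.eq, Ideal.mem_span_singleton]
    refine ⟨f.divX.divX, ?_⟩
    nth_rw 1 [← f.divX_mul_X_add]
    nth_rw 1 [← f.divX.divX_mul_X_add]
    ring
  eq_zero r s h := by
    change Ideal.Quotient.mk _ (C _) + Ideal.Quotient.mk _ (C _) * Ideal.Quotient.mk _ X = 0 at h
    rw [← map_mul, ← map_add, Ideal.Quotient.eq_zero_iff_mem, Ideal.mem_span_singleton,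
      X_pow_dvd_iff] at h
    exact ⟨by simpa using h 0, by simpa using h 1⟩

lemma ct2_algebraMap (r : R) : ct2 R (algebraMap R (Rn R 2) r) = r := by
  change (evalRingHom 0) (C r) = r
  simp

lemma ct2_tn : ct2 R (tn R 2) = 0 := by
  change (evalRingHom 0) X = 0
  simp

/-- The isomorphism `R ≅ I`, `r ↦ r t`. -/
def itEquiv [Module R (It R)]
    (h : ∀ (r : R) (x : It R),
      (LinearMap.toSpanSingleton R (It R) x r : Rn R 2) = algebraMap R (Rn R 2) r * x) :
    R ≃ₗ[R] It R :=
  LinearEquiv.ofBijective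
    (LinearMap.toSpanSingleton R (It R) ⟨tn R 2, Ideal.mem_span_singleton_self _⟩) <| by
    have hd := isDualNumbers_tn R
    constructor
    · rw [injective_iff_map_eq_zero]
      intro r hr
      refine (hd.eq_zero 0 r ?_).2
      rw [map_zero, zero_add]
      exact (h r ⟨tn R 2, Ideal.mem_span_singleton_self _⟩).symm.trans (congrArg Subtype.val hr)
    · rintro ⟨x, hx⟩
      obtain ⟨y, rfl⟩ := Ideal.mem_span_singleton.1 hx
      obtain ⟨r, s, rfl⟩ := hd.exists_eq y
      refine ⟨r, Subtype.ext ((h r ⟨tn R 2, Ideal.mem_span_singleton_self _⟩).trans ?_)⟩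
      linear_combination -algebraMap R (Rn R 2) s * hd.mul_self

end DoubleStructure

set_option synthInstance.maxHeartbeats 1000000 in
set_option maxHeartbeats 2000000 in
/-- Let `R` be a 2-dimensional regular local ring containing `ℂ` with residue field `ℂ`,
with maximal ideal `𝔪`, `A = R[t]/(t²)` and `I = (t) ⊆ A`. Regarding `𝔪 ⊗_R I` and `𝔪`
as `A`-modules on which `t` acts as `0`, there is an isomorphism of `R`-modules
`Ext¹_A(𝔪, 𝔪 ⊗_R I) ≅ ((𝔪/𝔪²) ⊗_R I) ⊕ R`. -/
theorem ext_maximalIdeal_iso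
    {R : Type u} [CommRing R] [IsLocalRing R] [IsNoetherianRing R] [Algebra ℂ R]
    (hdim : ringKrullDim R = 2)
    (hreg : ∃ a b : R, IsLocalRing.maximalIdeal R = Ideal.span {a, b})
    (hres : ∀ r : R, ∃ c : ℂ, r - algebraMap ℂ R c ∈ IsLocalRing.maximalIdeal R) :
    -- `I` as an `R`-module (restriction of scalars along `R → A`)
    letI : Module R ↥(It R) := Module.compHom _ (algebraMap R (Rn R 2))
    -- `𝔪` as an `A`-module with `t` acting as `0`
    letI : Module (Rn R 2) ↥(IsLocalRing.maximalIdeal R) := Module.compHom _ (ct2 R)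
    -- `𝔪 ⊗_R I` as an `A`-module with `t` acting as `0`
    letI : Module (Rn R 2) (↥(IsLocalRing.maximalIdeal R) ⊗[R] ↥(It R)) :=
      Module.compHom _ (ct2 R)
    -- the `R`-module structure of `Ext¹_A(𝔪, 𝔪 ⊗_R I)` (restriction of scalars)
    letI : Module R
        (((Ext (Rn R 2) (ModuleCat (Rn R 2)) 1).obj
            (Opposite.op (ModuleCat.of (Rn R 2) ↥(IsLocalRing.maximalIdeal R)))).obj
          (ModuleCat.of (Rn R 2) (↥(IsLocalRing.maximalIdeal R) ⊗[R] ↥(It R)))) :=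
      Module.compHom _ (algebraMap R (Rn R 2))
    Nonempty
      ((((Ext (Rn R 2) (ModuleCat (Rn R 2)) 1).obj
            (Opposite.op (ModuleCat.of (Rn R 2) ↥(IsLocalRing.maximalIdeal R)))).obj
          (ModuleCat.of (Rn R 2) (↥(IsLocalRing.maximalIdeal R) ⊗[R] ↥(It R)))) ≃ₗ[R]
        (((↥(IsLocalRing.maximalIdeal R) ⧸
            Submodule.comap (IsLocalRing.maximalIdeal R).subtype
              ((IsLocalRing.maximalIdeal R) ^ 2)) ⊗[R] ↥(It R)) × R)) := by
  let : Module R ↥(It R) := Module.compHom _ (algebraMap R (Rn R 2))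
  let : Module (Rn R 2) ↥(IsLocalRing.maximalIdeal R) := Module.compHom _ (ct2 R)
  let : Module (Rn R 2) (↥(IsLocalRing.maximalIdeal R) ⊗[R] ↥(It R)) :=
    Module.compHom _ (ct2 R)
  let : Module R
      (((Ext (Rn R 2) (ModuleCat (Rn R 2)) 1).obj
          (Opposite.op (ModuleCat.of (Rn R 2) ↥(IsLocalRing.maximalIdeal R)))).obj
        (ModuleCat.of (Rn R 2) (↥(IsLocalRing.maximalIdeal R) ⊗[R] ↥(It R)))) :=
    Module.compHom _ (algebraMap R (Rn R 2))
  obtain ⟨a, b, hm⟩ := hreg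
  let ε := itEquiv R (fun _ _ => rfl)
  have := isScalarTower_compHom (M := IsLocalRing.maximalIdeal R) (ct2 R) (ct2_algebraMap R)
  have := isScalarTower_compHom (M := IsLocalRing.maximalIdeal R ⊗[R] It R) (ct2 R)
    (ct2_algebraMap R)
  obtain ⟨E, hE⟩ := exists_ext_one_addEquiv (N := IsLocalRing.maximalIdeal R ⊗[R] It R)
    (isDualNumbers_tn R)
    (fun x => (congrArg (· • x) (ct2_tn R)).trans (zero_smul R x))
    (fun x => (congrArg (· • x) (ct2_tn R)).trans (zero_smul R x))
    hm (regular_pair_of_ringKrullDim_eq_two hdim hm).1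
    (fun _ _ => exists_syzygy_of_ringKrullDim_eq_two hdim hm)
    (TensorProduct.congr (LinearEquiv.refl R _) ε.symm ≪≫ₗ TensorProduct.rid R _)
  exact ⟨{ E with map_smul' := hE } ≪≫ₗ LinearEquiv.prodCongr
    ((TensorProduct.rid R _).symm ≪≫ₗ TensorProduct.congr (LinearEquiv.refl R _) ε)
    (LinearEquiv.refl R R)⟩
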